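/- Fix an integer k ≥ 2. Let Q be a finite directed graph admitting a coloring c : V → ℤ/kℤ and with all mixed-walk directed distances finite. Then for every arrow v → w of Q and every vertex z, the difference δ(w,z) − δ(v,z) lies in {−1, k−1}; equivalently, δ(v,z) − δ(w,z) lies in {1, 1−k}. -/

import Mathlib

/-- `MixedWalk k A v w ℓ` : there is a mixed walk from `v` to `w` of total cost `ℓ`,
where each step traverses an arrow of `A` either forwards at cost `1` or backwards at
cost `k - 1`. -/
inductive MixedWalk {V : Type*} (k : ℕ) (A : V → V → Prop) : V → V → ℕ → Prop
  | nil (v : V) : MixedWalk k A v v 0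
  | fwd {v w x : V} {ℓ : ℕ} : A v w → MixedWalk k A w x ℓ → MixedWalk k A v x (ℓ + 1)
  | bwd {v w x : V} {ℓ : ℕ} : A w v → MixedWalk k A w x ℓ → MixedWalk k A v x (ℓ + (k - 1))

/-- A coloring of a directed graph: `c(w) = c(v) + 1` along every arrow `v → w`. -/
def IsColoring {V : Type*} (k : ℕ) (A : V → V → Prop) (c : V → ZMod k) : Prop :=
  ∀ v w : V, A v w → c w = c v + 1

theorem mixedWalk_color {V : Type} (k : ℕ) (hk : 2 ≤ k)
    (A : V → V → Prop) (c : V → ZMod k) (hc : IsColoring k A c) {v w : V} {l : ℕ}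
    (h : MixedWalk k A v w l) : c w = c v + (l : ZMod k) := by
  induction h with
  | nil v => simp
  | fwd a _ ih => rw [ih, hc _ _ a]; push_cast; ring
  | bwd a _ ih =>
    rw [ih, hc _ _ a]
    push_cast [Nat.cast_sub (show 1 ≤ k by omega)]
    simp
    ring

/-- In a finite directed graph admitting a coloring, with all mixed-walk directed
distances finite, for every arrow `v → w` and every vertex `z` the difference
`δ(w,z) − δ(v,z)` lies in `{−1, k−1}`. -/
theorem stmt_4 (k : ℕ) (hk : 2 ≤ k) {V : Type} [Fintype V]
    (A : V → V → Prop) (c : V → ZMod k) (hc : IsColoring k A c)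
    (δ : V → V → ℕ)
    (hδ : ∀ v w : V, IsLeast {ℓ : ℕ | MixedWalk k A v w ℓ} (δ v w)) :
    ∀ v w z : V, A v w →
      ((δ w z : ℤ) - (δ v z : ℤ) = -1 ∨ (δ w z : ℤ) - (δ v z : ℤ) = (k : ℤ) - 1) := by
  intro v w z hvw
  have h1 := mixedWalk_color k hk A c hc (hδ v z).1
  have h2 := mixedWalk_color k hk A c hc (hδ w z).1
  have h3 := hc v w hvw
  have h4 : δ v z ≤ δ w z + 1 := (hδ v z).2 (MixedWalk.fwd hvw (hδ w z).1)
  have h5 : δ w z ≤ δ v z + (k - 1) := (hδ w z).2 (MixedWalk.bwd hvw (hδ v z).1)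
  have h6 : (((δ w z : ℤ) - δ v z + 1 : ℤ) : ZMod k) = 0 := by
    push_cast
    have h7 : c v + (δ v z : ZMod k) = c v + 1 + (δ w z : ZMod k) := by
      rw [← h1, ← h3, ← h2]
    linear_combination -h7
  haveI : NeZero k := ⟨by omega⟩
  rw [ZMod.intCast_zmod_eq_zero_iff_dvd] at h6
  obtain ⟨m, hm⟩ := h6
  have hm0 : 0 ≤ m := by
    by_contra! h
    nlinarith
  have hm1 : m ≤ 1 := by
    by_contra! h
    have : (δ w z : ℤ) - δ v z + 1 ≤ k := by omega
    nlinarith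
  have : m = 0 ∨ m = 1 := by omega
  rcases this with rfl | rfl
  · left; linarith
  · right; linarith
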